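/- arXiv:1804.01857 — 4 statements merged into one kernel-verified Lean document; each statement's English description precedes it below -/
import Mathlib

section
/- Let n = r + s, let Σ₁ be a positive semidefinite real r × r matrix and Σ₂ a positive semidefinite real s × s matrix, and let Σ = diag(Σ₁, Σ₂) be the block diagonal n × n matrix. Let A, N₁, …, N_m, H₁, …, H_v be real n × n matrices partitioned conformably with blocks A₁₁, N_{k,11}, H_{i,11} of size r × r, let C be a real p × n matrix with C = [C₁ C₂], C₁ of size p × r, and let K = (k_{ij}) be a positive semidefinite real v × v matrix. If Aᵀ Σ + Σ A + ∑_{k=1}^{m} N_kᵀ Σ N_k + ∑_{i,j=1}^{v} H_iᵀ Σ H_j k_{ij} ≤ −Cᵀ C (in the sense that the difference of the two sides is negative semidefinite), then A₁₁ᵀ Σ₁ + Σ₁ A₁₁ + ∑_{k=1}^{m} N_{k,11}ᵀ Σ₁ N_{k,11} + ∑_{i,j=1}^{v} H_{i,11}ᵀ Σ₁ H_{j,11} k_{ij} ≤ −C₁ᵀ C₁. -/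
open Matrix

/-- The left upper block of a congruence of a block diagonal matrix. -/
theorem toBlocks₁₁_transpose_mul_fromBlocks_diagonal_mul
    {m n R : Type*} [Fintype m] [Fintype n] [CommRing R]
    (S : Matrix m m R) (T : Matrix n n R) (X Y : Matrix (m ⊕ n) (m ⊕ n) R) :
    (Xᵀ * fromBlocks S 0 0 T * Y).toBlocks₁₁
      = X.toBlocks₁₁ᵀ * S * Y.toBlocks₁₁ + X.toBlocks₂₁ᵀ * T * Y.toBlocks₂₁ := by
  conv_lhs => rw [← fromBlocks_toBlocks X, ← fromBlocks_toBlocks Y]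
  simp [fromBlocks_transpose, fromBlocks_multiply]

open scoped MatrixOrder Matrix.Norms.L2Operator in
/-- Summing congruences of a positive semidefinite matrix against positive semidefinite weights
gives a positive semidefinite matrix. -/
theorem posSemidef_sum_smul_transpose_mul_mul
    {ι m n : Type*} [Fintype ι] [Fintype m] [Fintype n]
    {K : Matrix ι ι ℝ} (hK : K.PosSemidef) {T : Matrix m m ℝ} (hT : T.PosSemidef)
    (G : ι → Matrix m n ℝ) :
    (∑ i, ∑ j, K i j • ((G i)ᵀ * T * G j)).PosSemidef := by
  classical
  obtain ⟨B, rfl⟩ := CStarAlgebra.nonneg_iff_eq_star_mul_self.mp hK.nonneg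
  have h : ∑ i, ∑ j, (star B * B) i j • ((G i)ᵀ * T * G j)
      = ∑ l, (∑ i, B l i • G i)ᴴ * T * (∑ j, B l j • G j) := by
    simp only [star_eq_conjTranspose, mul_apply, transpose_apply, conjTranspose_eq_transpose_of_trivial,
      transpose_sum, transpose_smul, Finset.sum_smul, Matrix.sum_mul, Matrix.mul_sum,
      Matrix.smul_mul, Matrix.mul_smul, Finset.smul_sum, smul_smul]
    rw [Finset.sum_comm_cycle]
    refine Finset.sum_congr rfl fun l _ => Finset.sum_comm.trans ?_
    refine Finset.sum_congr rfl fun j _ => Finset.sum_congr rfl fun i _ => ?_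
    rw [mul_comm]
  rw [h]
  exact posSemidef_sum _ fun l _ => hT.conjTranspose_mul_mul_same _

/-- Truncation of the balanced observability Gramian inequality (3.2) to the reduced
system: the left upper blocks of a solution of the observability inequality satisfy the
corresponding reduced inequality. Here `S ≤ T` means `(T - S).PosSemidef`. -/
theorem truncation_observability_inequality
    (r s p m v : ℕ)
    (S1 : Matrix (Fin r) (Fin r) ℝ) (S2 : Matrix (Fin s) (Fin s) ℝ)
    (hS1 : S1.PosSemidef) (hS2 : S2.PosSemidef)
    (A : Matrix (Fin r ⊕ Fin s) (Fin r ⊕ Fin s) ℝ)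
    (N : Fin m → Matrix (Fin r ⊕ Fin s) (Fin r ⊕ Fin s) ℝ)
    (H : Fin v → Matrix (Fin r ⊕ Fin s) (Fin r ⊕ Fin s) ℝ)
    (C : Matrix (Fin p) (Fin r ⊕ Fin s) ℝ)
    (K : Matrix (Fin v) (Fin v) ℝ) (hK : K.PosSemidef)
    (hineq : (-(Cᵀ * C)
        - (Aᵀ * fromBlocks S1 0 0 S2 + fromBlocks S1 0 0 S2 * A
          + ∑ k : Fin m, (N k)ᵀ * fromBlocks S1 0 0 S2 * N k
          + ∑ i : Fin v, ∑ j : Fin v,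
              K i j • ((H i)ᵀ * fromBlocks S1 0 0 S2 * H j))).PosSemidef) :
    (-((C.submatrix id Sum.inl)ᵀ * C.submatrix id Sum.inl)
      - ((A.toBlocks₁₁)ᵀ * S1 + S1 * A.toBlocks₁₁
        + ∑ k : Fin m, ((N k).toBlocks₁₁)ᵀ * S1 * (N k).toBlocks₁₁
        + ∑ i : Fin v, ∑ j : Fin v,
            K i j • (((H i).toBlocks₁₁)ᵀ * S1 * (H j).toBlocks₁₁))).PosSemidef := by
  have hN : (∑ k : Fin m, (N k).toBlocks₂₁ᵀ * S2 * (N k).toBlocks₂₁).PosSemidef :=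
    posSemidef_sum _ fun k _ => by
      simpa using hS2.conjTranspose_mul_mul_same (N k).toBlocks₂₁
  have hH := posSemidef_sum_smul_transpose_mul_mul hK hS2 fun i => (H i).toBlocks₂₁
  convert (hineq.submatrix Sum.inl).add (hN.add hH) using 1
  have hC : (Cᵀ * C).toBlocks₁₁ = (C.submatrix id Sum.inl)ᵀ * C.submatrix id Sum.inl := rfl
  have hA : (Aᵀ * fromBlocks S1 0 0 S2).toBlocks₁₁ = A.toBlocks₁₁ᵀ * S1 := by
    conv_lhs => rw [← fromBlocks_toBlocks A]
    simp [fromBlocks_transpose, fromBlocks_multiply]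
  have hA' : (fromBlocks S1 0 0 S2 * A).toBlocks₁₁ = S1 * A.toBlocks₁₁ := by
    conv_lhs => rw [← fromBlocks_toBlocks A]
    simp [fromBlocks_multiply]
  have hX (X Y : Matrix (Fin r ⊕ Fin s) (Fin r ⊕ Fin s) ℝ) (a b : Fin r) :
      (Xᵀ * fromBlocks S1 0 0 S2 * Y) (Sum.inl a) (Sum.inl b)
        = (X.toBlocks₁₁ᵀ * S1 * Y.toBlocks₁₁) a b + (X.toBlocks₂₁ᵀ * S2 * Y.toBlocks₂₁) a b :=
    congrFun₂ (toBlocks₁₁_transpose_mul_fromBlocks_diagonal_mul S1 S2 X Y) a b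
  ext a b
  have hA_apply : (Aᵀ * fromBlocks S1 0 0 S2) (Sum.inl a) (Sum.inl b) = _ := congrFun₂ hA a b
  have hA'_apply : (fromBlocks S1 0 0 S2 * A) (Sum.inl a) (Sum.inl b) = _ := congrFun₂ hA' a b
  have hC_apply : (Cᵀ * C) (Sum.inl a) (Sum.inl b) = _ := congrFun₂ hC a b
  simp only [submatrix_apply, Matrix.sub_apply, Matrix.add_apply, Matrix.neg_apply, Matrix.sum_apply,
    Matrix.smul_apply, hX,
    hA_apply, hA'_apply, hC_apply, smul_add, Finset.sum_add_distrib]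
  ring
end

section
/- Let n = r + s, let Σ₁ be a symmetric positive definite real r × r matrix and Σ₂ a symmetric positive definite real s × s matrix, and let Σ = diag(Σ₁, Σ₂) be the block diagonal n × n matrix. Let A, N₁, …, N_m, H₁, …, H_v be real n × n matrices partitioned conformably with blocks A₁₁, N_{k,11}, H_{i,11} of size r × r, let B be a real n × m matrix with B = [B₁; B₂], B₁ of size r × m, and let K = (k_{ij}) be a positive semidefinite real v × v matrix. If Aᵀ Σ⁻¹ + Σ⁻¹ A + ∑_{k=1}^{m} N_kᵀ Σ⁻¹ N_k + ∑_{i,j=1}^{v} H_iᵀ Σ⁻¹ H_j k_{ij} ≤ −Σ⁻¹ B Bᵀ Σ⁻¹ (in the sense that the difference of the two sides is negative semidefinite), then A₁₁ᵀ Σ₁⁻¹ + Σ₁⁻¹ A₁₁ + ∑_{k=1}^{m} N_{k,11}ᵀ Σ₁⁻¹ N_{k,11} + ∑_{i,j=1}^{v} H_{i,11}ᵀ Σ₁⁻¹ H_{j,11} k_{ij} ≤ −Σ₁⁻¹ B₁ B₁ᵀ Σ₁⁻¹. -/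
open Matrix

/-- The upper left block of `Mᵀ D M'` for a block diagonal matrix `D`. -/
lemma Matrix.toBlocks₁₁_transpose_mul_fromBlocks_mul {m n : Type*} [Fintype m] [Fintype n]
    (P : Matrix m m ℝ) (Q : Matrix n n ℝ) (M M' : Matrix (m ⊕ n) (m ⊕ n) ℝ) :
    (Mᵀ * fromBlocks P 0 0 Q * M').toBlocks₁₁ =
      M.toBlocks₁₁ᵀ * P * M'.toBlocks₁₁ + M.toBlocks₂₁ᵀ * Q * M'.toBlocks₂₁ := by
  conv_lhs => rw [← fromBlocks_toBlocks M, ← fromBlocks_toBlocks M']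
  simp [fromBlocks_transpose, fromBlocks_multiply]

lemma Matrix.toBlocks₁₁_sum {ι m n : Type*} (t : Finset ι)
    (f : ι → Matrix (m ⊕ n) (m ⊕ n) ℝ) :
    (∑ i ∈ t, f i).toBlocks₁₁ = ∑ i ∈ t, (f i).toBlocks₁₁ := by
  ext a b
  simp [toBlocks₁₁, Matrix.sum_apply]

open scoped MatrixOrder in
/-- A congruence sum weighted by a positive semidefinite matrix is positive semidefinite. -/
lemma Matrix.PosSemidef.sum_smul_transpose_mul_mul {ι m n : Type*} [Fintype ι]
    [Fintype m] [Fintype n] {K : Matrix ι ι ℝ} (hK : K.PosSemidef)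
    {Q : Matrix m m ℝ} (hQ : Q.PosSemidef) (H : ι → Matrix m n ℝ) :
    (∑ i, ∑ j, K i j • ((H i)ᵀ * Q * H j)).PosSemidef := by
  classical
  obtain ⟨C, rfl⟩ := CStarAlgebra.nonneg_iff_eq_star_mul_self.mp hK.nonneg
  have key : ∑ i, ∑ j, (star C * C) i j • ((H i)ᵀ * Q * H j) =
      ∑ l, (∑ i, C l i • H i)ᴴ * Q * ∑ j, C l j • H j := by
    simp only [star_eq_conjTranspose, mul_apply, transpose_apply, Finset.sum_smul,
      conjTranspose_eq_transpose_of_trivial, transpose_sum, transpose_smul, Matrix.sum_mul,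
      Matrix.mul_sum, Matrix.smul_mul, Matrix.mul_smul]
    rw [Finset.sum_comm_cycle]
    refine Finset.sum_congr rfl fun l _ => ?_
    rw [Finset.sum_comm]
    simp only [Finset.smul_sum, smul_smul]
    exact Finset.sum_congr rfl fun j _ => Finset.sum_congr rfl fun i _ => by rw [mul_comm]
  rw [key]
  exact posSemidef_sum _ fun l _ => hQ.conjTranspose_mul_mul_same _

/-- Truncation of the balanced reachability Gramian inequality (3.1) to the reduced
system: the left upper blocks of a solution of the reachability inequality satisfy the
corresponding reduced inequality. Here `S ≤ T` means `(T - S).PosSemidef`. -/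
theorem truncation_reachability_inequality
    (r s m v : ℕ)
    (S1 : Matrix (Fin r) (Fin r) ℝ) (S2 : Matrix (Fin s) (Fin s) ℝ)
    (hS1 : S1.PosDef) (hS2 : S2.PosDef)
    (A : Matrix (Fin r ⊕ Fin s) (Fin r ⊕ Fin s) ℝ)
    (N : Fin m → Matrix (Fin r ⊕ Fin s) (Fin r ⊕ Fin s) ℝ)
    (H : Fin v → Matrix (Fin r ⊕ Fin s) (Fin r ⊕ Fin s) ℝ)
    (B : Matrix (Fin r ⊕ Fin s) (Fin m) ℝ)
    (K : Matrix (Fin v) (Fin v) ℝ) (hK : K.PosSemidef)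
    (hineq : (-((fromBlocks S1 0 0 S2)⁻¹ * B * Bᵀ * (fromBlocks S1 0 0 S2)⁻¹)
        - (Aᵀ * (fromBlocks S1 0 0 S2)⁻¹ + (fromBlocks S1 0 0 S2)⁻¹ * A
          + ∑ k : Fin m, (N k)ᵀ * (fromBlocks S1 0 0 S2)⁻¹ * N k
          + ∑ i : Fin v, ∑ j : Fin v,
              K i j • ((H i)ᵀ * (fromBlocks S1 0 0 S2)⁻¹ * H j))).PosSemidef) :
    (-(S1⁻¹ * B.submatrix Sum.inl id * (B.submatrix Sum.inl id)ᵀ * S1⁻¹)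
      - ((A.toBlocks₁₁)ᵀ * S1⁻¹ + S1⁻¹ * A.toBlocks₁₁
        + ∑ k : Fin m, ((N k).toBlocks₁₁)ᵀ * S1⁻¹ * (N k).toBlocks₁₁
        + ∑ i : Fin v, ∑ j : Fin v,
            K i j • (((H i).toBlocks₁₁)ᵀ * S1⁻¹ * (H j).toBlocks₁₁))).PosSemidef := by
  have hinv : (fromBlocks S1 0 0 S2)⁻¹ = fromBlocks S1⁻¹ 0 0 S2⁻¹ := by
    have h1 : S1 * S1⁻¹ = 1 := mul_nonsing_inv _ ((isUnit_iff_isUnit_det _).mp hS1.isUnit)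
    have h2 : S2 * S2⁻¹ = 1 := mul_nonsing_inv _ ((isUnit_iff_isUnit_det _).mp hS2.isUnit)
    apply inv_eq_right_inv
    simp [fromBlocks_multiply, h1, h2]
  rw [hinv] at hineq
  have hQ : (S2⁻¹).PosSemidef := hS2.inv.posSemidef
  have hN : (∑ k, (N k).toBlocks₂₁ᵀ * S2⁻¹ * (N k).toBlocks₂₁).PosSemidef :=
    posSemidef_sum _ fun k _ => by
      simpa using hQ.conjTranspose_mul_mul_same (N k).toBlocks₂₁
  have hH := hK.sum_smul_transpose_mul_mul hQ fun i => (H i).toBlocks₂₁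
  have hA : (Aᵀ * fromBlocks S1⁻¹ 0 0 S2⁻¹).toBlocks₁₁ = A.toBlocks₁₁ᵀ * S1⁻¹ := by
    conv_lhs => rw [← fromBlocks_toBlocks A]
    simp [fromBlocks_transpose, fromBlocks_multiply]
  have hA' : (fromBlocks S1⁻¹ 0 0 S2⁻¹ * A).toBlocks₁₁ = S1⁻¹ * A.toBlocks₁₁ := by
    conv_lhs => rw [← fromBlocks_toBlocks A]
    simp [fromBlocks_multiply]
  have hB : (fromBlocks S1⁻¹ 0 0 S2⁻¹ * B * Bᵀ * fromBlocks S1⁻¹ 0 0 S2⁻¹).toBlocks₁₁ =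
      S1⁻¹ * B.submatrix Sum.inl id * (B.submatrix Sum.inl id)ᵀ * S1⁻¹ := by
    have h : B = fromRows (B.submatrix Sum.inl id) (B.submatrix Sum.inr id) := by
      ext (i | i) j <;> rfl
    conv_lhs => rw [h]
    simp [transpose_fromRows, fromBlocks_mul_fromRows, fromBlocks_multiply]
  have hadd (X Y : Matrix (Fin r ⊕ Fin s) (Fin r ⊕ Fin s) ℝ) :
      (X + Y).toBlocks₁₁ = X.toBlocks₁₁ + Y.toBlocks₁₁ := rfl
  have hsub (X Y : Matrix (Fin r ⊕ Fin s) (Fin r ⊕ Fin s) ℝ) :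
      (X - Y).toBlocks₁₁ = X.toBlocks₁₁ - Y.toBlocks₁₁ := rfl
  have hneg (X : Matrix (Fin r ⊕ Fin s) (Fin r ⊕ Fin s) ℝ) :
      (-X).toBlocks₁₁ = -X.toBlocks₁₁ := rfl
  have hsmul (c : ℝ) (X : Matrix (Fin r ⊕ Fin s) (Fin r ⊕ Fin s) ℝ) :
      (c • X).toBlocks₁₁ = c • X.toBlocks₁₁ := rfl
  have hblock := hineq.submatrix Sum.inl
  change (toBlocks₁₁ _).PosSemidef at hblock
  simp only [hsub, hneg, hadd, toBlocks₁₁_sum, hsmul, hA, hA', hB,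
    toBlocks₁₁_transpose_mul_fromBlocks_mul, smul_add, Finset.sum_add_distrib] at hblock
  convert (hblock.add hN).add hH using 1
  abel
end

section
/- Let T > 0, let z, f, a : [0,T] → ℝ be measurable bounded functions with z(t) ≥ 0 and f(t) ≥ 0 for all t ∈ [0,T], and let β : [0,T] → ℝ be a nonnegative integrable function. If z(t) ≤ a(t) − f(t) + ∫₀ᵗ β(s) z(s) ds for all t ∈ [0,T], then f(t) ≤ a(t) + ∫₀ᵗ a(s) β(s) exp(∫ₛᵗ β(w) dw) ds for all t ∈ [0,T]. -/
open MeasureTheory Set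

/-- Postcomposing an absolutely continuous function with a Lipschitz function preserves absolute
continuity. -/
theorem LipschitzOnWith.comp_absolutelyContinuousOnInterval {X Y : Type*} [PseudoMetricSpace X]
    [PseudoMetricSpace Y] {K : NNReal} {g : X → Y} {f : ℝ → X} {b t : ℝ}
    (hg : LipschitzOnWith K g (f '' uIcc b t)) (hf : AbsolutelyContinuousOnInterval f b t) :
    AbsolutelyContinuousOnInterval (g ∘ f) b t := by
  rw [absolutelyContinuousOnInterval_iff] at hf ⊢
  intro ε hε
  obtain ⟨δ, hδ, h⟩ := hf (ε / (K + 1)) (by positivity)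
  refine ⟨δ, hδ, fun E hE hEδ ↦ ?_⟩
  have hsum := h E hE hEδ
  rw [lt_div_iff₀ (by positivity)] at hsum
  refine lt_of_le_of_lt ?_ hsum
  rw [Finset.sum_mul]
  refine Finset.sum_le_sum fun i hi ↦ ?_
  have hmem := hE.1 i hi
  have hlip := hg.dist_le_mul _ (mem_image_of_mem f hmem.1) _ (mem_image_of_mem f hmem.2)
  simp only [Function.comp_apply]
  nlinarith [dist_nonneg (x := f (E.2 i).1) (y := f (E.2 i).2)]

/-- The exponential of a real absolutely continuous function is absolutely continuous. -/
theorem AbsolutelyContinuousOnInterval.exp {f : ℝ → ℝ} {b t : ℝ}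
    (hf : AbsolutelyContinuousOnInterval f b t) :
    AbsolutelyContinuousOnInterval (fun s ↦ Real.exp (f s)) b t := by
  obtain ⟨C, hC⟩ := hf.exists_bound
  obtain ⟨K, hK⟩ := Real.contDiff_exp.contDiffOn.exists_lipschitzOnWith (n := 1)
    one_ne_zero (convex_Icc (-C) C) isCompact_Icc
  refine (hK.mono ?_).comp_absolutelyContinuousOnInterval hf
  rintro _ ⟨s, hs, rfl⟩
  exact abs_le.mp (hC s hs)

/-- **Gronwall's inequality** in integral form, with an integrable kernel `β`. -/
theorem integral_mul_le_integral_mul_exp_of_le_add_integral {b t : ℝ} (hbt : b ≤ t)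
    {β z a : ℝ → ℝ} (hβ : IntervalIntegrable β volume b t)
    (hβz : IntervalIntegrable (fun s ↦ β s * z s) volume b t)
    (haβ : IntervalIntegrable (fun s ↦ a s * β s) volume b t)
    (hβ_nonneg : ∀ s ∈ Icc b t, 0 ≤ β s)
    (hz : ∀ s ∈ Icc b t, z s ≤ a s + ∫ r in b..s, β r * z r) :
    ∫ s in b..t, β s * z s ≤ ∫ s in b..t, a s * β s * Real.exp (∫ w in s..t, β w) := by
  set G : ℝ → ℝ := fun s ↦ ∫ r in b..s, β r * z r with hG
  set E : ℝ → ℝ := fun s ↦ Real.exp (∫ w in s..t, β w) with hE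
  have hG_ac : AbsolutelyContinuousOnInterval G b t :=
    hβz.absolutelyContinuousOnInterval_intervalIntegral left_mem_uIcc
  have hE_ac : AbsolutelyContinuousOnInterval E b t := by
    have h := (hβ.absolutelyContinuousOnInterval_intervalIntegral right_mem_uIcc).neg.exp
    simpa only [hE, Pi.neg_apply, ← intervalIntegral.integral_symm] using h
  have hGE := hG_ac.fun_mul hE_ac
  have hGE_eq : ∫ s in b..t, deriv (fun s ↦ G s * E s) s = ∫ s in b..t, β s * z s := by
    rw [hGE.integral_deriv_eq_sub]
    simp [hG, hE]
  rw [← hGE_eq]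
  refine intervalIntegral.integral_mono_ae_restrict hbt hGE.intervalIntegrable_deriv
    (haβ.mul_continuousOn hE_ac.continuousOn) ?_
  rw [Filter.EventuallyLE, ae_restrict_iff' measurableSet_Icc]
  filter_upwards [hβz.ae_hasDerivAt_integral, hβ.ae_hasDerivAt_integral] with s hGs hBs hs
  have hs' : s ∈ uIcc b t := by rwa [uIcc_of_le hbt]
  have hEs : HasDerivAt E (E s * -β s) s := by
    have h := (hBs hs' t right_mem_uIcc).fun_neg.exp
    simpa only [hE, ← intervalIntegral.integral_symm] using h
  rw [((hGs hs' b left_mem_uIcc).fun_mul hEs).deriv]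
  have hmul := mul_le_mul_of_nonneg_left (hz s hs)
    (mul_nonneg (hβ_nonneg s hs) (Real.exp_pos (∫ w in s..t, β w)).le)
  simp only [hE]
  linarith

/-- Abstract Gronwall-type lemma (deterministic skeleton of the error-bound proof):
if 0 ≤ z(t) ≤ a(t) − f(t) + ∫₀ᵗ β z with f ≥ 0, then
f(t) ≤ a(t) + ∫₀ᵗ a(s) β(s) exp(∫ₛᵗ β) ds. -/
theorem gronwall_error_bound_skeleton
    (T : ℝ) (hT : 0 < T) (z f a : ℝ → ℝ)
    (hzm : Measurable z) (hfm : Measurable f) (ham : Measurable a)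
    (hzb : ∃ C, ∀ t ∈ Set.Icc (0:ℝ) T, |z t| ≤ C)
    (hfb : ∃ C, ∀ t ∈ Set.Icc (0:ℝ) T, |f t| ≤ C)
    (hab : ∃ C, ∀ t ∈ Set.Icc (0:ℝ) T, |a t| ≤ C)
    (hznonneg : ∀ t ∈ Set.Icc (0:ℝ) T, 0 ≤ z t)
    (hfnonneg : ∀ t ∈ Set.Icc (0:ℝ) T, 0 ≤ f t)
    (β : ℝ → ℝ) (hβm : Measurable β)
    (hβnonneg : ∀ t ∈ Set.Icc (0:ℝ) T, 0 ≤ β t)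
    (hβint : IntervalIntegrable β MeasureTheory.volume 0 T)
    (hineq : ∀ t ∈ Set.Icc (0:ℝ) T, z t ≤ a t - f t + ∫ s in (0:ℝ)..t, β s * z s) :
    ∀ t ∈ Set.Icc (0:ℝ) T,
      f t ≤ a t + ∫ s in (0:ℝ)..t, a s * β s * Real.exp (∫ w in s..t, β w) := by
  intro t ht
  have hsub : Icc 0 t ⊆ Icc 0 T := Icc_subset_Icc_right ht.2
  have hβt : IntervalIntegrable β volume 0 t :=
    hβint.mono_set (by rwa [uIcc_of_le ht.1, uIcc_of_le hT.le])
  have hmul {g : ℝ → ℝ} (hg : Measurable g) (hgb : ∃ C, ∀ s ∈ Icc (0 : ℝ) T, |g s| ≤ C) :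
      IntervalIntegrable (fun s ↦ g s * β s) volume 0 t := by
    obtain ⟨C, hC⟩ := hgb
    rw [intervalIntegrable_iff_integrableOn_Icc_of_le ht.1] at hβt ⊢
    refine hβt.bdd_mul (c := C) hg.aestronglyMeasurable ?_
    exact (ae_restrict_iff' measurableSet_Icc).2 (.of_forall fun s hs ↦ hC s (hsub hs))
  have hgronwall := integral_mul_le_integral_mul_exp_of_le_add_integral (z := z) ht.1 hβt
    (by simpa only [mul_comm] using hmul hzm hzb) (hmul ham hab)
    (fun s hs ↦ hβnonneg s (hsub hs))
    (fun s hs ↦ by linarith [hineq s (hsub hs), hfnonneg s (hsub hs)])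
  linarith [hineq t ht, hznonneg t ht]
end

section
/- Let P and Q be symmetric positive definite real n × n matrices. Then there exist an invertible real n × n matrix S and a diagonal real n × n matrix Σ with strictly positive diagonal entries such that S P Sᵀ = Σ and (S⁻¹)ᵀ Q S⁻¹ = Σ. -/
open Matrix

open scoped MatrixOrder Matrix.Norms.L2Operator in
/-- A real positive definite matrix factors as `L * Lᵀ` with `L` invertible. -/
theorem Matrix.PosDef.exists_isUnit_eq_mul_transpose {n : Type*} [Fintype n] [DecidableEq n]
    {P : Matrix n n ℝ} (hP : P.PosDef) :
    ∃ L : Matrix n n ℝ, IsUnit L ∧ P = L * Lᵀ := by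
  obtain ⟨y, hy⟩ := CStarAlgebra.nonneg_iff_eq_star_mul_self.mp hP.posSemidef.nonneg
  rw [star_eq_conjTranspose, conjTranspose_eq_transpose_of_trivial] at hy
  refine ⟨yᵀ, ?_, by rw [transpose_transpose, hy]⟩
  have hu := hP.isUnit
  rw [isUnit_iff_isUnit_det, hy, det_mul] at hu
  exact (isUnit_iff_isUnit_det _).mpr (isUnit_of_mul_isUnit_left hu)

/-- Two real positive definite matrices are simultaneously diagonalizable, one by congruence and
the other by the inverse congruence, with the first one reduced to the identity. -/
theorem Matrix.PosDef.exists_simultaneous_diagonalization {n : Type*} [Fintype n] [DecidableEq n]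
    {P Q : Matrix n n ℝ} (hP : P.PosDef) (hQ : Q.PosDef) :
    ∃ (W : Matrix n n ℝ) (l : n → ℝ), IsUnit W ∧ (∀ i, 0 < l i) ∧
      P = W * Wᵀ ∧ Wᵀ * Q * W = diagonal l := by
  obtain ⟨L, hL, rfl⟩ := hP.exists_isUnit_eq_mul_transpose
  have hM : (Lᵀ * Q * L).PosDef := by
    rw [← conjTranspose_eq_transpose_of_trivial]
    exact hQ.conjTranspose_mul_mul_same (mulVec_injective_of_isUnit hL)
  set U := hM.isHermitian.eigenvectorUnitary
  have hU : (U : Matrix n n ℝ) * (U : Matrix n n ℝ)ᵀ = 1 := by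
    rw [← conjTranspose_eq_transpose_of_trivial]
    exact Unitary.coe_mul_star_self U
  have hdiag : (U : Matrix n n ℝ)ᵀ * (Lᵀ * Q * L) * U = diagonal hM.isHermitian.eigenvalues := by
    rw [← conjTranspose_eq_transpose_of_trivial (U : Matrix n n ℝ)]
    have h := hM.isHermitian.conjStarAlgAut_star_eigenvectorUnitary
    rw [Unitary.conjStarAlgAut_star_apply] at h
    exact h
  refine ⟨L * U, hM.isHermitian.eigenvalues, hL.mul (IsUnit.of_mul_eq_one _ hU),
    hM.eigenvalues_pos, ?_, ?_⟩
  · rw [transpose_mul, Matrix.mul_assoc, ← Matrix.mul_assoc (U : Matrix n n ℝ), hU,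
      Matrix.one_mul]
  · rw [← hdiag, transpose_mul]
    simp only [Matrix.mul_assoc]

/-- Existence of the balancing transformation: for symmetric positive definite
Gramians P and Q there is an invertible S and a positive diagonal Σ with
S P Sᵀ = Σ and S⁻ᵀ Q S⁻¹ = Σ. -/
theorem balancing_transformation_exists
    (n : ℕ) (P Q : Matrix (Fin n) (Fin n) ℝ)
    (hP : P.PosDef) (hQ : Q.PosDef) :
    ∃ (S : Matrix (Fin n) (Fin n) ℝ) (d : Fin n → ℝ),
      IsUnit S ∧ (∀ i, 0 < d i) ∧
      S * P * Sᵀ = Matrix.diagonal d ∧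
      (S⁻¹)ᵀ * Q * S⁻¹ = Matrix.diagonal d := by
  obtain ⟨W, l, hW, hl, rfl, hWQ⟩ := hP.exists_simultaneous_diagonalization hQ
  have hWi : W⁻¹ * W = 1 := nonsing_inv_mul W ((isUnit_iff_isUnit_det W).mp hW)
  have hd (i : Fin n) : 0 < √(l i) := Real.sqrt_pos.mpr (hl i)
  set e : Fin n → ℝ := fun i ↦ √√(l i)
  have he (i : Fin n) : e i ≠ 0 := (Real.sqrt_pos.mpr (hd i)).ne'
  have hee (i : Fin n) : e i * e i = √(l i) := Real.mul_self_sqrt (hd i).le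
  have hST : (diagonal e * W⁻¹) * (W * diagonal e⁻¹) = 1 := by
    rw [Matrix.mul_assoc, ← Matrix.mul_assoc W⁻¹, hWi, Matrix.one_mul, diagonal_mul_diagonal,
      ← diagonal_one]
    congr 1
    ext i
    exact mul_inv_cancel₀ (he i)
  refine ⟨diagonal e * W⁻¹, fun i ↦ √(l i), IsUnit.of_mul_eq_one _ hST, hd, ?_, ?_⟩
  · calc diagonal e * W⁻¹ * (W * Wᵀ) * (diagonal e * W⁻¹)ᵀ
        = diagonal e * (W⁻¹ * W) * (W⁻¹ * W)ᵀ * diagonal e := by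
          simp only [transpose_mul, diagonal_transpose, Matrix.mul_assoc]
      _ = diagonal fun i ↦ √(l i) := by
          simp only [hWi, transpose_one, Matrix.mul_one, diagonal_mul_diagonal, hee]
  · rw [inv_eq_right_inv hST]
    calc (W * diagonal e⁻¹)ᵀ * Q * (W * diagonal e⁻¹)
        = diagonal e⁻¹ * (Wᵀ * Q * W) * diagonal e⁻¹ := by
          simp only [transpose_mul, diagonal_transpose, Matrix.mul_assoc]
      _ = diagonal fun i ↦ √(l i) := by
          rw [hWQ, diagonal_mul_diagonal, diagonal_mul_diagonal]
          congr 1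
          ext i
          have hll : l i = e i * e i * (e i * e i) := by
            rw [hee, Real.mul_self_sqrt (hl i).le]
          rw [← hee, Pi.inv_apply]
          nth_rewrite 1 [hll]
          field_simp [he i]
end
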